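/- arXiv:2002.00727 — 12 statements merged into one kernel-verified Lean document; each statement's English description precedes it below -/
import Mathlib

section
/- Weak duality for the IGML problem: for every m ∈ ℝ^p with m ≥ 0 and every α ∈ ℝ^N with α ≥ 0, one has D_λ(α) ≤ P_λ(m). -/
open Finset

/-- The vector `m_λ(α)` with `(m_λ(α))_k = (1/(λη)) · max((Cα)_k − λ, 0)`. -/
noncomputable def mLam {p N : ℕ} (C : Matrix (Fin p) (Fin N) ℝ) (lam eta : ℝ)
    (α : Fin N → ℝ) : Fin p → ℝ :=
  fun k => (1 / (lam * eta)) * max ((∑ j, C k j * α j) - lam) 0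

/-- The primal objective `P_λ(m)`. -/
noncomputable def primalObj {p N : ℕ} (C : Matrix (Fin p) (Fin N) ℝ) (t : Fin N → ℝ)
    (lam eta : ℝ) (m : Fin p → ℝ) : ℝ :=
  (∑ j, max (t j - ∑ k, C k j * m k) 0 ^ 2)
    + lam * ((∑ k, m k) + eta / 2 * ∑ k, m k ^ 2)

/-- The dual objective `D_λ(α)`. -/
noncomputable def dualObj {p N : ℕ} (C : Matrix (Fin p) (Fin N) ℝ) (t : Fin N → ℝ)
    (lam eta : ℝ) (α : Fin N → ℝ) : ℝ :=
  -(1 / 4) * (∑ j, α j ^ 2) + (∑ j, t j * α j)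
    - lam * eta / 2 * ∑ k, mLam C lam eta α k ^ 2

/-- Fenchel–Young inequality for the squared hinge `s ↦ max s 0 ^ 2`. -/
theorem mul_sub_sq_le_max_sq {a : ℝ} (ha : 0 ≤ a) (s : ℝ) :
    s * a - 1 / 4 * a ^ 2 ≤ max s 0 ^ 2 := by
  nlinarith [sq_nonneg (max s 0 - a / 2), mul_le_mul_of_nonneg_right (le_max_left s 0) ha]

/-- Fenchel–Young inequality for `x ↦ c / 2 * x ^ 2` on the half-line `0 ≤ x`. -/
theorem mul_le_half_sq_add_half_sq {c x : ℝ} (hc : 0 < c) (hx : 0 ≤ x) (a : ℝ) :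
    a * x ≤ c / 2 * x ^ 2 + c / 2 * (1 / c * max a 0) ^ 2 := by
  have hmax : c * (1 / c * max a 0) = max a 0 := by field_simp
  nlinarith [mul_nonneg hc.le (sq_nonneg (x - 1 / c * max a 0)),
    mul_le_mul_of_nonneg_right (le_max_left a 0) hx]

/-- Weak duality for the IGML problem: for every `m ≥ 0` and `α ≥ 0`,
`D_λ(α) ≤ P_λ(m)`. -/
theorem igml_weak_duality {p N : ℕ} (hp : 0 < p) (hN : 0 < N)
    (C : Matrix (Fin p) (Fin N) ℝ) (t : Fin N → ℝ)
    (lam eta : ℝ) (hlam : 0 < lam) (heta : 0 < eta)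
    (m : Fin p → ℝ) (hm : ∀ k, 0 ≤ m k)
    (α : Fin N → ℝ) (hα : ∀ j, 0 ≤ α j) :
    dualObj C t lam eta α ≤ primalObj C t lam eta m := by
  have hfit := sum_le_sum fun j (_ : j ∈ univ) =>
    mul_sub_sq_le_max_sq (hα j) (t j - ∑ k, C k j * m k)
  have hreg := sum_le_sum fun k (_ : k ∈ univ) =>
    mul_le_half_sq_add_half_sq (mul_pos hlam heta) (hm k) ((∑ j, C k j * α j) - lam)
  have hswap : ∑ j, (∑ k, C k j * m k) * α j = ∑ k, (∑ j, C k j * α j) * m k := by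
    simp only [sum_mul]
    rw [sum_comm]
    exact sum_congr rfl fun k _ => sum_congr rfl fun j _ => by ring
  simp only [sub_mul, sum_sub_distrib, sum_add_distrib, ← mul_sum] at hfit hreg
  simp only [dualObj, primalObj, mLam]
  linarith
end

section
/- Characterization of the trivial-solution regime: define α̂ ∈ ℝ^N by α̂_j := 2·max(t_j, 0) for each j. If λ ≥ max_{k=1,…,p} (C α̂)_k, then the zero vector m = 0 is a minimizer of P_λ over {m ∈ ℝ^p : m ≥ 0}. -/
open Finset

/-- The tangent line at `0` lies below the squared hinge `x ↦ max (a - x) 0 ^ 2`. -/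
theorem sq_max_zero_le_sq_max_sub_zero_add (a x : ℝ) :
    max a 0 ^ 2 ≤ max (a - x) 0 ^ 2 + 2 * max a 0 * x := by
  have h : max a 0 * a = max a 0 ^ 2 := by
    rcases le_total a 0 with ha | ha
    · simp [max_eq_right ha]
    · rw [max_eq_left ha, sq]
  have h' : max a 0 * (a - x) ≤ max a 0 * max (a - x) 0 :=
    mul_le_mul_of_nonneg_left (le_max_left _ _) (le_max_right _ _)
  nlinarith [sq_nonneg (max (a - x) 0 - max a 0)]

/-- Characterization of the trivial-solution regime: with `α̂_j := 2·max(t_j, 0)`,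
if `λ ≥ max_k (C α̂)_k` then `m = 0` minimizes `P_λ` over the nonnegative orthant. -/
theorem igml_trivial_regime {p N : ℕ} (hp : 0 < p) (hN : 0 < N)
    (C : Matrix (Fin p) (Fin N) ℝ) (t : Fin N → ℝ)
    (lam eta : ℝ) (hlam : 0 < lam) (heta : 0 < eta)
    (hmax : Finset.univ.sup' (Finset.univ_nonempty_iff.mpr (Fin.pos_iff_nonempty.mp hp))
        (fun k => ∑ j, C k j * (2 * max (t j) 0)) ≤ lam) :
    ∀ m : Fin p → ℝ, (∀ k, 0 ≤ m k) →
      primalObj C t lam eta (fun _ => 0) ≤ primalObj C t lam eta m := by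
  intro m hm
  have hbound (k : Fin p) : ∑ j, C k j * (2 * max (t j) 0) ≤ lam :=
    (Finset.le_sup' (fun k => ∑ j, C k j * (2 * max (t j) 0)) (mem_univ k)).trans hmax
  have hhinge : ∑ j, max (t j) 0 ^ 2 ≤ (∑ j, max (t j - ∑ k, C k j * m k) 0 ^ 2)
      + ∑ j, 2 * max (t j) 0 * ∑ k, C k j * m k := by
    rw [← sum_add_distrib]
    exact sum_le_sum fun j _ => sq_max_zero_le_sq_max_sub_zero_add _ _
  have hswap : ∑ j, 2 * max (t j) 0 * ∑ k, C k j * m k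
      = ∑ k, (∑ j, C k j * (2 * max (t j) 0)) * m k := by
    simp_rw [mul_sum, sum_mul]
    rw [sum_comm]
    exact sum_congr rfl fun k _ => sum_congr rfl fun j _ => by ring
  have hlinear : ∑ k, (∑ j, C k j * (2 * max (t j) 0)) * m k ≤ lam * ∑ k, m k := by
    rw [mul_sum]
    exact sum_le_sum fun k _ => mul_le_mul_of_nonneg_right (hbound k) (hm k)
  have hridge : 0 ≤ lam * (eta / 2 * ∑ k, m k ^ 2) := by positivity
  have hzero : primalObj C t lam eta (fun _ => 0) = ∑ j, max (t j) 0 ^ 2 := by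
    simp [primalObj]
  rw [hzero, primalObj, mul_add]
  linarith
end

section
/- Pruning bound (Lemma 1): let q ∈ ℝ^N with q ≥ 0, let r ≥ 0, and let k′ be a descendant of feature k. Then C_{k′,:} q + r·‖C_{k′,:}‖₂ ≤ Prune(k | q, r). Consequently, if Prune(k | q, r) ≤ T for some T ∈ ℝ, then C_{k′,:} q + r·‖C_{k′,:}‖₂ ≤ T holds for every descendant k′ of k. -/
open Finset

/-- The matrix `C` with entries `C_{k,j} = σ_j · (x_{a_j,k} − x_{b_j,k})²`. -/
def pairC {n p N : ℕ} (x : Fin n → Fin p → ℝ) (sgn : Fin N → ℝ)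
    (a b : Fin N → Fin n) : Matrix (Fin p) (Fin N) ℝ :=
  fun k j => sgn j * (x (a j) k - x (b j) k) ^ 2

/-- The pruning criterion
`Prune(k | q, r) = Σ_{j : σ_j = 1} q_j · max(x_{a_j,k}, x_{b_j,k})²
  + r · sqrt(Σ_j max(x_{a_j,k}, x_{b_j,k})⁴)`. -/
noncomputable def prune {n p N : ℕ} (x : Fin n → Fin p → ℝ) (sgn : Fin N → ℝ)
    (a b : Fin N → Fin n) (k : Fin p) (q : Fin N → ℝ) (r : ℝ) : ℝ :=
  (∑ j ∈ Finset.univ.filter (fun j => sgn j = 1), q j * max (x (a j) k) (x (b j) k) ^ 2)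
    + r * Real.sqrt (∑ j, max (x (a j) k) (x (b j) k) ^ 4)

/-- The squared difference of two nonnegative reals is at most the squared maximum of any
upper bounds for them. -/
theorem sub_sq_le_max_sq {u v s t : ℝ} (hu : 0 ≤ u) (hv : 0 ≤ v) (hus : u ≤ s) (hvt : v ≤ t) :
    (u - v) ^ 2 ≤ max s t ^ 2 := by
  have hs := le_max_left s t
  have ht := le_max_right s t
  exact sq_le_sq' (by linarith) (by linarith)

/-- Pruning bound (Lemma 1): for `q ≥ 0`, `r ≥ 0` and `k′` a descendant of `k`,
`C_{k′,:} q + r·‖C_{k′,:}‖₂ ≤ Prune(k | q, r)`; consequently if `Prune(k | q, r) ≤ T`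
then `C_{k′,:} q + r·‖C_{k′,:}‖₂ ≤ T`. -/
theorem prune_bound {n p N : ℕ} (x : Fin n → Fin p → ℝ)
    (hx : ∀ i k, 0 ≤ x i k) (sgn : Fin N → ℝ)
    (hsgn : ∀ j, sgn j = 1 ∨ sgn j = -1) (a b : Fin N → Fin n)
    (q : Fin N → ℝ) (hq : ∀ j, 0 ≤ q j) (r : ℝ) (hr : 0 ≤ r)
    (k k' : Fin p) (hdesc : ∀ i, x i k' ≤ x i k) :
    (∑ j, pairC x sgn a b k' j * q j)
        + r * Real.sqrt (∑ j, pairC x sgn a b k' j ^ 2) ≤ prune x sgn a b k q r ∧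
      ∀ T : ℝ, prune x sgn a b k q r ≤ T →
        (∑ j, pairC x sgn a b k' j * q j)
          + r * Real.sqrt (∑ j, pairC x sgn a b k' j ^ 2) ≤ T := by
  have hsq : ∀ j, (x (a j) k' - x (b j) k') ^ 2 ≤ max (x (a j) k) (x (b j) k) ^ 2 := fun j =>
    sub_sq_le_max_sq (hx _ _) (hx _ _) (hdesc _) (hdesc _)
  have hlin : ∑ j, pairC x sgn a b k' j * q j ≤
      ∑ j ∈ Finset.univ.filter (fun j => sgn j = 1),
        q j * max (x (a j) k) (x (b j) k) ^ 2 := by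
    rw [Finset.sum_filter]
    refine Finset.sum_le_sum fun j _ => ?_
    rcases hsgn j with h | h
    · rw [if_pos h, pairC, h, one_mul, mul_comm]
      exact mul_le_mul_of_nonneg_left (hsq j) (hq j)
    · rw [if_neg (by rw [h]; norm_num), pairC, h]
      have := mul_nonneg (sq_nonneg (x (a j) k' - x (b j) k')) (hq j)
      linarith
  have hquad : ∑ j, pairC x sgn a b k' j ^ 2 ≤ ∑ j, max (x (a j) k) (x (b j) k) ^ 4 := by
    refine Finset.sum_le_sum fun j _ => ?_
    have hs : sgn j ^ 2 = 1 := by rcases hsgn j with h | h <;> rw [h] <;> norm_num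
    rw [pairC, mul_pow, hs, one_mul]
    calc ((x (a j) k' - x (b j) k') ^ 2) ^ 2
        ≤ (max (x (a j) k) (x (b j) k) ^ 2) ^ 2 := pow_le_pow_left₀ (sq_nonneg _) (hsq j) 2
      _ = max (x (a j) k) (x (b j) k) ^ 4 := by ring
  have hmain : (∑ j, pairC x sgn a b k' j * q j)
      + r * Real.sqrt (∑ j, pairC x sgn a b k' j ^ 2) ≤ prune x sgn a b k q r :=
    add_le_add hlin (mul_le_mul_of_nonneg_left (Real.sqrt_le_sqrt hquad) hr)
  exact ⟨hmain, fun T hT => hmain.trans hT⟩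
end

section
/- Tighter pruning bound for binary features (Lemma 2): assume all feature values are binary, x_{i,k} ∈ {0,1}. Let q ∈ ℝ^N with q ≥ 0, let r ≥ 0, and let k′ be a descendant of feature k. Then C_{k′,:} q + r·‖C_{k′,:}‖₂ ≤ PruneBin(k | q, r). Moreover, the first summand of PruneBin(k | q, r) is no larger than the first summand Σ_{j : σ_j = +1} q_j·max(x_{a_j,k}, x_{b_j,k})² of Prune(k | q, r). -/
open Finset

/-- First summand of the pruning criterion `Prune(k | q, r)`. -/
noncomputable def pruneFirst {n p N : ℕ} (x : Fin n → Fin p → ℝ) (sgn : Fin N → ℝ)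
    (a b : Fin N → Fin n) (k : Fin p) (q : Fin N → ℝ) : ℝ :=
  ∑ j ∈ Finset.univ.filter (fun j => sgn j = 1), q j * max (x (a j) k) (x (b j) k) ^ 2

/-- First summand of the binary pruning criterion `PruneBin(k | q, r)`, where
`D_i = {j : σ_j = 1, a_j = i}` and `S_i = {j : σ_j = −1, a_j = i}`. -/
noncomputable def pruneBinFirst {n p N : ℕ} (x : Fin n → Fin p → ℝ) (sgn : Fin N → ℝ)
    (a b : Fin N → Fin n) (k : Fin p) (q : Fin N → ℝ) : ℝ :=
  ∑ i : Fin n,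
    max (∑ j ∈ Finset.univ.filter (fun j => sgn j = 1 ∧ a j = i), q j * x (b j) k)
      (x i k * ((∑ j ∈ Finset.univ.filter (fun j => sgn j = 1 ∧ a j = i), q j)
        - ∑ j ∈ Finset.univ.filter (fun j => sgn j = -1 ∧ a j = i), q j * (1 - x (b j) k)))

/-- The binary pruning criterion `PruneBin(k | q, r)`. -/
noncomputable def pruneBin {n p N : ℕ} (x : Fin n → Fin p → ℝ) (sgn : Fin N → ℝ)
    (a b : Fin N → Fin n) (k : Fin p) (q : Fin N → ℝ) (r : ℝ) : ℝ :=
  pruneBinFirst x sgn a b k q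
    + r * Real.sqrt (∑ j, max (x (a j) k) (x (b j) k))

/-- Summing over `D_i` and then over the samples `i` is summing over all D-pairs (`c = 1`);
likewise for S-pairs (`c = -1`). -/
lemma sum_sum_filter_sign {n N : ℕ} (sgn : Fin N → ℝ) (a : Fin N → Fin n) (c : ℝ)
    (f : Fin N → ℝ) :
    ∑ i, ∑ j ∈ Finset.univ.filter (fun j => sgn j = c ∧ a j = i), f j
      = ∑ j ∈ Finset.univ.filter (fun j => sgn j = c), f j := by
  rw [← Finset.sum_fiberwise _ a]
  simp only [Finset.filter_filter]

/-- The inner product `C_{k,:} q`, split over the samples `i` into `D_i` and `S_i`. -/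
lemma sum_pairC_mul {n p N : ℕ} (x : Fin n → Fin p → ℝ) (sgn : Fin N → ℝ)
    (hsgn : ∀ j, sgn j = 1 ∨ sgn j = -1) (a b : Fin N → Fin n) (k : Fin p)
    (q : Fin N → ℝ) :
    ∑ j, pairC x sgn a b k j * q j =
      ∑ i, ((∑ j ∈ Finset.univ.filter (fun j => sgn j = 1 ∧ a j = i),
          q j * (x i k - x (b j) k) ^ 2)
        - ∑ j ∈ Finset.univ.filter (fun j => sgn j = -1 ∧ a j = i),
          q j * (x i k - x (b j) k) ^ 2) := by
  have hfiber (c : ℝ) :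
      ∑ i, ∑ j ∈ Finset.univ.filter (fun j => sgn j = c ∧ a j = i),
          q j * (x i k - x (b j) k) ^ 2
        = ∑ j ∈ Finset.univ.filter (fun j => sgn j = c),
          q j * (x (a j) k - x (b j) k) ^ 2 := by
    rw [← sum_sum_filter_sign sgn a]
    refine Finset.sum_congr rfl fun i _ => Finset.sum_congr rfl fun j hj => ?_
    rw [(Finset.mem_filter.1 hj).2.2]
  rw [Finset.sum_sub_distrib, hfiber, hfiber, Finset.sum_filter, Finset.sum_filter,
    ← Finset.sum_sub_distrib]
  refine Finset.sum_congr rfl fun j _ => ?_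
  rcases hsgn j with h | h <;> norm_num [pairC, h, mul_comm]

/-- For binary features, `C_{k′,:} q` is at most the first summand of `PruneBin(k | q, r)`. -/
lemma sum_pairC_mul_le_pruneBinFirst {n p N : ℕ} (x : Fin n → Fin p → ℝ)
    (hbin : ∀ i k, x i k = 0 ∨ x i k = 1) (sgn : Fin N → ℝ)
    (hsgn : ∀ j, sgn j = 1 ∨ sgn j = -1) (a b : Fin N → Fin n)
    (q : Fin N → ℝ) (hq : ∀ j, 0 ≤ q j)
    (k k' : Fin p) (hdesc : ∀ i, x i k' ≤ x i k) :
    ∑ j, pairC x sgn a b k' j * q j ≤ pruneBinFirst x sgn a b k q := by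
  rw [sum_pairC_mul x sgn hsgn]
  refine Finset.sum_le_sum fun i _ => ?_
  rcases hbin i k' with hi | hi
  · refine le_max_of_le_left ((sub_le_self _ ?_).trans ?_)
    · exact Finset.sum_nonneg fun j _ => mul_nonneg (hq j) (sq_nonneg _)
    · refine Finset.sum_le_sum fun j _ => mul_le_mul_of_nonneg_left ?_ (hq j)
      have hb := hdesc (b j)
      rcases hbin (b j) k' with h | h <;> rw [h] at hb <;> norm_num [hi, h, hb]
  · have hik : x i k = 1 := by
      have hd := hdesc i
      rcases hbin i k with h | h <;> linarith
    refine le_max_of_le_right ?_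
    rw [hik, hi, one_mul]
    refine sub_le_sub (Finset.sum_le_sum fun j _ => ?_) (Finset.sum_le_sum fun j _ => ?_)
    · refine mul_le_of_le_one_right (hq j) ?_
      rcases hbin (b j) k' with h | h <;> norm_num [h]
    · refine mul_le_mul_of_nonneg_left ?_ (hq j)
      have hb := hdesc (b j)
      rcases hbin (b j) k' with h | h <;> rw [h] at hb <;> norm_num [h, hb]

/-- For binary features, `‖C_{k′,:}‖₂²` is at most the quantity under the square root in
`PruneBin(k | q, r)`. -/
lemma sum_pairC_sq_le {n p N : ℕ} (x : Fin n → Fin p → ℝ)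
    (hbin : ∀ i k, x i k = 0 ∨ x i k = 1) (sgn : Fin N → ℝ)
    (hsgn : ∀ j, sgn j = 1 ∨ sgn j = -1) (a b : Fin N → Fin n)
    (k k' : Fin p) (hdesc : ∀ i, x i k' ≤ x i k) :
    ∑ j, pairC x sgn a b k' j ^ 2 ≤ ∑ j, max (x (a j) k) (x (b j) k) := by
  refine Finset.sum_le_sum fun j _ => ?_
  have hsq : pairC x sgn a b k' j ^ 2 = (x (a j) k' - x (b j) k') ^ 4 := by
    rcases hsgn j with h | h <;> simp only [pairC, h] <;> ring
  rw [hsq]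
  refine le_trans ?_ (max_le_max (hdesc (a j)) (hdesc (b j)))
  rcases hbin (a j) k' with h | h <;> rcases hbin (b j) k' with h₂ | h₂ <;> norm_num [h, h₂]

/-- For binary features, the first summand of `PruneBin(k | q, r)` is at most that of
`Prune(k | q, r)`. -/
lemma pruneBinFirst_le_pruneFirst {n p N : ℕ} (x : Fin n → Fin p → ℝ)
    (hbin : ∀ i k, x i k = 0 ∨ x i k = 1) (sgn : Fin N → ℝ) (a b : Fin N → Fin n)
    (q : Fin N → ℝ) (hq : ∀ j, 0 ≤ q j) (k : Fin p) :
    pruneBinFirst x sgn a b k q ≤ pruneFirst x sgn a b k q := by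
  rw [pruneFirst, ← sum_sum_filter_sign sgn a]
  refine Finset.sum_le_sum fun i _ => max_le ?_ ?_
  · refine Finset.sum_le_sum fun j _ => mul_le_mul_of_nonneg_left ?_ (hq j)
    rcases hbin (a j) k with h | h <;> rcases hbin (b j) k with h₂ | h₂ <;> norm_num [h, h₂]
  · rcases hbin i k with hi | hi
    · rw [hi, zero_mul]
      exact Finset.sum_nonneg fun j _ => mul_nonneg (hq j) (sq_nonneg _)
    · rw [hi, one_mul]
      refine (sub_le_self _ (Finset.sum_nonneg fun j _ => mul_nonneg (hq j) ?_)).trans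
        (Finset.sum_le_sum fun j hj => le_mul_of_one_le_right (hq j) ?_)
      · rcases hbin (b j) k with h | h <;> norm_num [h]
      · rw [(Finset.mem_filter.1 hj).2.2, hi]
        exact one_le_pow₀ (le_max_left _ _)

/-- Tighter pruning bound for binary features (Lemma 2): if all feature values are binary,
then for `q ≥ 0`, `r ≥ 0` and `k′` a descendant of `k`,
`C_{k′,:} q + r·‖C_{k′,:}‖₂ ≤ PruneBin(k | q, r)`, and the first summand of
`PruneBin(k | q, r)` is no larger than the first summand of `Prune(k | q, r)`. -/
theorem pruneBin_bound {n p N : ℕ} (x : Fin n → Fin p → ℝ)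
    (hbin : ∀ i k, x i k = 0 ∨ x i k = 1) (sgn : Fin N → ℝ)
    (hsgn : ∀ j, sgn j = 1 ∨ sgn j = -1) (a b : Fin N → Fin n)
    (q : Fin N → ℝ) (hq : ∀ j, 0 ≤ q j) (r : ℝ) (hr : 0 ≤ r)
    (k k' : Fin p) (hdesc : ∀ i, x i k' ≤ x i k) :
    (∑ j, pairC x sgn a b k' j * q j)
        + r * Real.sqrt (∑ j, pairC x sgn a b k' j ^ 2) ≤ pruneBin x sgn a b k q r ∧
      pruneBinFirst x sgn a b k q ≤ pruneFirst x sgn a b k q := by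
  exact ⟨add_le_add
    (sum_pairC_mul_le_pruneBinFirst x hbin sgn hsgn a b q hq k k' hdesc)
    (mul_le_mul_of_nonneg_left
      (Real.sqrt_le_sqrt (sum_pairC_sq_le x hbin sgn hsgn a b k k' hdesc)) hr),
    pruneBinFirst_le_pruneFirst x hbin sgn a b q hq k⟩
end

section
/- Duality gap bound (DGB, Theorem 1): suppose α* is a maximizer of D_λ over the nonnegative orthant {α ∈ ℝ^N : α ≥ 0}. Then for every m ∈ ℝ^p with m ≥ 0 and every α ∈ ℝ^N with α ≥ 0, ‖α − α*‖₂² ≤ 4·(P_λ(m) − D_λ(α)). -/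
open Finset

/-- Convexity of the square of the positive part, in terms of `mLam`. -/
theorem sq_mLam_convex_comb_le {p N : ℕ} (C : Matrix (Fin p) (Fin N) ℝ) {lam eta : ℝ}
    (hlam : 0 < lam) (heta : 0 < eta) (α β : Fin N → ℝ) {a b : ℝ} (ha : 0 ≤ a) (hb : 0 ≤ b)
    (hab : a + b = 1) (k : Fin p) :
    mLam C lam eta (fun j => a * α j + b * β j) k ^ 2
      ≤ a * mLam C lam eta α k ^ 2 + b * mLam C lam eta β k ^ 2 := by
  have hpos : 0 ≤ 1 / (lam * eta) := by positivity
  have hsum : ∑ j, C k j * (a * α j + b * β j)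
      = a * (∑ j, C k j * α j) + b * ∑ j, C k j * β j := by
    rw [Finset.mul_sum, Finset.mul_sum, ← Finset.sum_add_distrib]
    exact Finset.sum_congr rfl fun j _ => by ring
  simp only [mLam, hsum]
  set x := ∑ j, C k j * α j
  set y := ∑ j, C k j * β j
  have hmax : max (a * x + b * y - lam) 0 ≤ a * max (x - lam) 0 + b * max (y - lam) 0 := by
    apply max_le
    · calc a * x + b * y - lam = a * (x - lam) + b * (y - lam) := by linear_combination lam * hab
        _ ≤ _ := by gcongr <;> exact le_max_left _ _
    · positivity
  set u := max (x - lam) 0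
  set v := max (y - lam) 0
  have hsq : max (a * x + b * y - lam) 0 ^ 2 ≤ a * u ^ 2 + b * v ^ 2 :=
    calc _ ≤ (a * u + b * v) ^ 2 := by gcongr
      _ ≤ _ := by
        obtain rfl : b = 1 - a := by linarith
        nlinarith [mul_nonneg (mul_nonneg ha hb) (sq_nonneg (u - v))]
  calc _ = (1 / (lam * eta)) ^ 2 * max (a * x + b * y - lam) 0 ^ 2 := by ring
    _ ≤ (1 / (lam * eta)) ^ 2 * (a * u ^ 2 + b * v ^ 2) := by gcongr
    _ = _ := by ring

/-- Strong concavity of the dual objective. -/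
theorem dualObj_strong_concave {p N : ℕ} (C : Matrix (Fin p) (Fin N) ℝ) (t : Fin N → ℝ)
    {lam eta : ℝ} (hlam : 0 < lam) (heta : 0 < eta) (α β : Fin N → ℝ) {a b : ℝ} (ha : 0 ≤ a)
    (hb : 0 ≤ b) (hab : a + b = 1) :
    a * dualObj C t lam eta α + b * dualObj C t lam eta β
        + a * b / 4 * ∑ j, (α j - β j) ^ 2
      ≤ dualObj C t lam eta (fun j => a * α j + b * β j) := by
  have hreg : ∑ k, mLam C lam eta (fun j => a * α j + b * β j) k ^ 2
      ≤ a * (∑ k, mLam C lam eta α k ^ 2) + b * ∑ k, mLam C lam eta β k ^ 2 := by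
    rw [Finset.mul_sum, Finset.mul_sum, ← Finset.sum_add_distrib]
    exact Finset.sum_le_sum fun k _ => sq_mLam_convex_comb_le C hlam heta α β ha hb hab k
  have hlin : ∑ j, t j * (a * α j + b * β j)
      = a * (∑ j, t j * α j) + b * ∑ j, t j * β j := by
    rw [Finset.mul_sum, Finset.mul_sum, ← Finset.sum_add_distrib]
    exact Finset.sum_congr rfl fun j _ => by ring
  have hquad : ∑ j, (a * α j + b * β j) ^ 2
      = a * (∑ j, α j ^ 2) + b * (∑ j, β j ^ 2) - a * b * ∑ j, (α j - β j) ^ 2 := by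
    simp only [Finset.mul_sum, ← Finset.sum_add_distrib, ← Finset.sum_sub_distrib]
    refine Finset.sum_congr rfl fun j _ => ?_
    obtain rfl : b = 1 - a := by linarith
    ring
  have hscaled := mul_le_mul_of_nonneg_left hreg (by positivity : 0 ≤ lam * eta / 2)
  unfold dualObj
  rw [hlin, hquad]
  linarith

/-- Weak duality between `primalObj` and `dualObj` on the nonnegative orthants. -/
theorem dualObj_le_primalObj {p N : ℕ} (C : Matrix (Fin p) (Fin N) ℝ) (t : Fin N → ℝ)
    {lam eta : ℝ} (hlam : 0 < lam) (heta : 0 < eta) {m : Fin p → ℝ} (hm : ∀ k, 0 ≤ m k)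
    {α : Fin N → ℝ} (hα : ∀ j, 0 ≤ α j) :
    dualObj C t lam eta α ≤ primalObj C t lam eta m := by
  have hloss : ∑ j, (α j * (t j - ∑ k, C k j * m k) - 1 / 4 * α j ^ 2)
      ≤ ∑ j, max (t j - ∑ k, C k j * m k) 0 ^ 2 := by
    refine Finset.sum_le_sum fun j _ => ?_
    have h := mul_le_mul_of_nonneg_left (le_max_left (t j - ∑ k, C k j * m k) 0) (hα j)
    nlinarith [sq_nonneg (max (t j - ∑ k, C k j * m k) 0 - α j / 2)]
  have hreg : ∑ k, (m k * (∑ j, C k j * α j) - lam * m k - lam * eta / 2 * m k ^ 2)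
      ≤ ∑ k, lam * eta / 2 * mLam C lam eta α k ^ 2 := by
    refine Finset.sum_le_sum fun k _ => ?_
    have hM : (∑ j, C k j * α j) - lam ≤ lam * eta * mLam C lam eta α k := by
      have : lam * eta * mLam C lam eta α k = max ((∑ j, C k j * α j) - lam) 0 := by
        unfold mLam
        field_simp
      exact this ▸ le_max_left _ _
    have h := mul_le_mul_of_nonneg_left hM (hm k)
    nlinarith [mul_nonneg (mul_pos hlam heta).le (sq_nonneg (m k - mLam C lam eta α k))]
  have hswap : ∑ k, m k * (∑ j, C k j * α j) = ∑ j, α j * ∑ k, C k j * m k := by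
    simp only [Finset.mul_sum]
    rw [Finset.sum_comm]
    exact Finset.sum_congr rfl fun j _ => Finset.sum_congr rfl fun k _ => by ring
  have hcomm : ∑ j, α j * t j = ∑ j, t j * α j :=
    Finset.sum_congr rfl fun j _ => mul_comm _ _
  simp only [mul_sub, Finset.sum_sub_distrib, ← Finset.mul_sum] at hloss hreg
  unfold dualObj primalObj
  linarith

/-- Quadratic growth of the dual objective away from a maximizer over the nonnegative orthant. -/
theorem sum_sq_sub_le_of_isMaxOn_dualObj {p N : ℕ} (C : Matrix (Fin p) (Fin N) ℝ)
    (t : Fin N → ℝ) {lam eta : ℝ} (hlam : 0 < lam) (heta : 0 < eta) {αstar : Fin N → ℝ}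
    (hstar_nonneg : ∀ j, 0 ≤ αstar j)
    (hstar : IsMaxOn (dualObj C t lam eta) {α | ∀ j, 0 ≤ α j} αstar)
    {α : Fin N → ℝ} (hα : ∀ j, 0 ≤ α j) :
    ∑ j, (α j - αstar j) ^ 2
      ≤ 4 * (dualObj C t lam eta αstar - dualObj C t lam eta α) := by
  have hmax : dualObj C t lam eta α ≤ dualObj C t lam eta αstar := hstar hα
  have hstep : ∀ a : ℝ, 0 < a → a ≤ 1 → (1 - a) * ∑ j, (α j - αstar j) ^ 2
      ≤ 4 * (dualObj C t lam eta αstar - dualObj C t lam eta α) := by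
    intro a ha ha1
    have hb : 0 ≤ 1 - a := by linarith
    have hconc := dualObj_strong_concave C t hlam heta α αstar ha.le hb (by ring)
    have hle : dualObj C t lam eta (fun j => a * α j + (1 - a) * αstar j)
        ≤ dualObj C t lam eta αstar :=
      hstar fun j => add_nonneg (mul_nonneg ha.le (hα j)) (mul_nonneg hb (hstar_nonneg j))
    refine le_of_mul_le_mul_left ?_ ha
    linarith
  set n := ∑ j, (α j - αstar j) ^ 2
  set g := 4 * (dualObj C t lam eta αstar - dualObj C t lam eta α) with hg
  by_contra! hlt
  have hg0 : 0 ≤ g := by linarith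
  have hn : 0 < n := hg0.trans_lt hlt
  have h := hstep ((n - g) / (2 * n)) (div_pos (by linarith) (by linarith))
    ((div_le_one (by linarith)).2 (by linarith))
  have heq : (1 - (n - g) / (2 * n)) * n = (n + g) / 2 := by
    field_simp
    ring
  linarith

/-- Duality gap bound (DGB, Theorem 1): if `α*` maximizes `D_λ` over the
nonnegative orthant, then for every `m ≥ 0` and `α ≥ 0`,
`‖α − α*‖₂² ≤ 4·(P_λ(m) − D_λ(α))`. -/
theorem igml_duality_gap_bound {p N : ℕ} (hp : 0 < p) (hN : 0 < N)
    (C : Matrix (Fin p) (Fin N) ℝ) (t : Fin N → ℝ)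
    (lam eta : ℝ) (hlam : 0 < lam) (heta : 0 < eta)
    (αstar : Fin N → ℝ) (hstar_nonneg : ∀ j, 0 ≤ αstar j)
    (hstar : IsMaxOn (dualObj C t lam eta) {α | ∀ j, 0 ≤ α j} αstar)
    (m : Fin p → ℝ) (hm : ∀ k, 0 ≤ m k)
    (α : Fin N → ℝ) (hα : ∀ j, 0 ≤ α j) :
    (∑ j, (α j - αstar j) ^ 2)
      ≤ 4 * (primalObj C t lam eta m - dualObj C t lam eta α) := by
  have hgrowth := sum_sq_sub_le_of_isMaxOn_dualObj C t hlam heta hstar_nonneg hstar hα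
  have hweak := dualObj_le_primalObj C t hlam heta hm hstar_nonneg
  linarith
end

section
/- Regularization path bound (RPB, Theorem 2): let λ₀ > 0 and λ₁ > 0, let α₀* be a maximizer of D_{λ₀} over the nonnegative orthant {α ∈ ℝ^N : α ≥ 0}, and let α₁* be a maximizer of D_{λ₁} over the same orthant. Then ‖α₁* − ((λ₀ + λ₁)/(2λ₀))·α₀*‖₂² ≤ ‖((λ₀ − λ₁)/(2λ₀))·α₀*‖₂². -/
open Finset

theorem sq_max_add_le (a b : ℝ) :
    max (a + b) 0 ^ 2 ≤ max a 0 ^ 2 + 2 * b * max a 0 + b ^ 2 := by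
  rcases max_cases (a + b) 0 with ⟨h, h'⟩ | ⟨h, h'⟩ <;>
    rcases max_cases a 0 with ⟨k, k'⟩ | ⟨k, k'⟩ <;> rw [h, k] <;> nlinarith [sq_nonneg (a + b)]

theorem le_zero_of_forall_mul_le_sq {L K : ℝ}
    (h : ∀ s : ℝ, 0 < s → s ≤ 1 → s * L ≤ s ^ 2 * K) : L ≤ 0 := by
  by_contra! hL
  have hK : L ≤ K := by simpa using h 1 one_pos le_rfl
  have hK0 : 0 < K := hL.trans_le hK
  have hs := h (L / (2 * K)) (by positivity) (by rw [div_le_one (by positivity)]; linarith)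
  have e1 : L / (2 * K) * L = L ^ 2 / K / 2 := by field_simp
  have e2 : (L / (2 * K)) ^ 2 * K = L ^ 2 / K / 4 := by field_simp; norm_num
  have : 0 < L ^ 2 / K := by positivity
  rw [e1, e2] at hs
  linarith

theorem mLam_sq_add_smul_le {p N : ℕ} (C : Matrix (Fin p) (Fin N) ℝ) {lam eta : ℝ}
    (hlam : 0 < lam) (heta : 0 < eta) (α d : Fin N → ℝ) (s : ℝ) (k : Fin p) :
    lam * eta / 2 * mLam C lam eta (fun j => α j + s * d j) k ^ 2 ≤
      lam * eta / 2 * mLam C lam eta α k ^ 2 + s * (mLam C lam eta α k * ∑ j, C k j * d j)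
        + s ^ 2 * (1 / (2 * (lam * eta)) * (∑ j, C k j * d j) ^ 2) := by
  have hlin : ∑ j, C k j * (α j + s * d j) - lam
      = (∑ j, C k j * α j - lam) + s * ∑ j, C k j * d j := by
    simp only [mul_add, sum_add_distrib, mul_sum, mul_left_comm]
    ring
  simp only [mLam, hlin]
  have h := mul_le_mul_of_nonneg_left
    (sq_max_add_le (∑ j, C k j * α j - lam) (s * ∑ j, C k j * d j))
    (by positivity : 0 ≤ 1 / (2 * (lam * eta)))
  refine (le_of_eq ?_).trans (h.trans (le_of_eq ?_)) <;> field_simp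

theorem dualObj_add_smul_ge {p N : ℕ} (C : Matrix (Fin p) (Fin N) ℝ) (t : Fin N → ℝ)
    {lam eta : ℝ} (hlam : 0 < lam) (heta : 0 < eta) (α d : Fin N → ℝ) (s : ℝ) :
    dualObj C t lam eta α
      + s * (∑ j, (t j - α j / 2) * d j - ∑ k, mLam C lam eta α k * ∑ j, C k j * d j)
      - s ^ 2 * (1 / 4 * ∑ j, d j ^ 2 + ∑ k, 1 / (2 * (lam * eta)) * (∑ j, C k j * d j) ^ 2)
      ≤ dualObj C t lam eta (fun j => α j + s * d j) := by
  have hpen := sum_le_sum fun k (_ : k ∈ univ) => mLam_sq_add_smul_le C hlam heta α d s k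
  simp only [sum_add_distrib] at hpen
  rw [← mul_sum, ← mul_sum, ← mul_sum, ← mul_sum] at hpen
  have hquad : -(1 / 4) * (∑ j, (α j + s * d j) ^ 2) + ∑ j, t j * (α j + s * d j)
      = -(1 / 4) * (∑ j, α j ^ 2) + (∑ j, t j * α j) + s * ∑ j, (t j - α j / 2) * d j
        - s ^ 2 * (1 / 4 * ∑ j, d j ^ 2) := by
    simp only [mul_sum, ← sum_add_distrib, ← sum_sub_distrib]
    exact sum_congr rfl fun j _ => by ring
  unfold dualObj
  linarith

/-- First-order optimality condition for a maximizer of the dual objective. -/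
theorem variational_inequality_of_isMaxOn_dualObj {p N : ℕ} (C : Matrix (Fin p) (Fin N) ℝ)
    (t : Fin N → ℝ) {lam eta : ℝ} (hlam : 0 < lam) (heta : 0 < eta) {α z : Fin N → ℝ}
    (hα : ∀ j, 0 ≤ α j) (hmax : IsMaxOn (dualObj C t lam eta) {α | ∀ j, 0 ≤ α j} α)
    (hz : ∀ j, 0 ≤ z j) :
    ∑ j, (t j - α j / 2) * (z j - α j)
      - ∑ k, mLam C lam eta α k * ∑ j, C k j * (z j - α j) ≤ 0 := by
  refine le_zero_of_forall_mul_le_sq (K := 1 / 4 * ∑ j, (z j - α j) ^ 2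
    + ∑ k, 1 / (2 * (lam * eta)) * (∑ j, C k j * (z j - α j)) ^ 2) fun s hs hs1 => ?_
  have hfeas : (fun j => α j + s * (z j - α j)) ∈ {α : Fin N → ℝ | ∀ j, 0 ≤ α j} := fun j => by
    nlinarith [mul_nonneg hs.le (hz j), mul_nonneg (sub_nonneg.2 hs1) (hα j)]
  have hle : dualObj C t lam eta (fun j => α j + s * (z j - α j)) ≤ dualObj C t lam eta α :=
    hmax hfeas
  linarith [dualObj_add_smul_ge C t hlam heta α (fun j => z j - α j) s]

theorem mLam_mul_smul {p N : ℕ} (C : Matrix (Fin p) (Fin N) ℝ) {r : ℝ} (hr : 0 < r)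
    (lam eta : ℝ) (α : Fin N → ℝ) (k : Fin p) :
    mLam C (r * lam) eta (fun j => r * α j) k = mLam C lam eta α k := by
  have hlin : ∑ j, C k j * (r * α j) - r * lam = r * (∑ j, C k j * α j - lam) := by
    simp only [mul_sub, mul_sum, mul_left_comm]
  have hmax : max (r * (∑ j, C k j * α j - lam)) 0 = r * max (∑ j, C k j * α j - lam) 0 := by
    rw [mul_max_of_nonneg _ _ hr.le, mul_zero]
  simp only [mLam, hlin, hmax]
  field_simp

theorem mLam_monotone {p N : ℕ} (C : Matrix (Fin p) (Fin N) ℝ) {lam eta : ℝ}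
    (hlam : 0 < lam) (heta : 0 < eta) (α β : Fin N → ℝ) (k : Fin p) :
    0 ≤ (mLam C lam eta α k - mLam C lam eta β k) * ∑ j, C k j * (α j - β j) := by
  have hc : 0 < 1 / (lam * eta) := by positivity
  simp only [mLam, mul_sub (C k _), sum_sub_distrib]
  rw [← mul_sub, mul_assoc]
  refine mul_nonneg hc.le ?_
  rcases le_total (∑ j, C k j * α j) (∑ j, C k j * β j) with h | h
  · exact mul_nonneg_of_nonpos_of_nonpos
      (sub_nonpos.2 (max_le_max_right 0 (sub_le_sub_right h _))) (sub_nonpos.2 h)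
  · exact mul_nonneg
      (sub_nonneg.2 (max_le_max_right 0 (sub_le_sub_right h _))) (sub_nonneg.2 h)

/-- Regularization path bound (RPB, Theorem 2): if `α₀*` maximizes `D_{λ₀}` and `α₁*`
maximizes `D_{λ₁}` over the nonnegative orthant, then
`‖α₁* − ((λ₀+λ₁)/(2λ₀))·α₀*‖₂² ≤ ‖((λ₀−λ₁)/(2λ₀))·α₀*‖₂²`. -/
theorem igml_regularization_path_bound {p N : ℕ} (hp : 0 < p) (hN : 0 < N)
    (C : Matrix (Fin p) (Fin N) ℝ) (t : Fin N → ℝ)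
    (eta : ℝ) (heta : 0 < eta)
    (lam0 lam1 : ℝ) (hlam0 : 0 < lam0) (hlam1 : 0 < lam1)
    (α0 : Fin N → ℝ) (hα0_nonneg : ∀ j, 0 ≤ α0 j)
    (hα0 : IsMaxOn (dualObj C t lam0 eta) {α | ∀ j, 0 ≤ α j} α0)
    (α1 : Fin N → ℝ) (hα1_nonneg : ∀ j, 0 ≤ α1 j)
    (hα1 : IsMaxOn (dualObj C t lam1 eta) {α | ∀ j, 0 ≤ α j} α1) :
    (∑ j, (α1 j - (lam0 + lam1) / (2 * lam0) * α0 j) ^ 2)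
      ≤ ∑ j, ((lam0 - lam1) / (2 * lam0) * α0 j) ^ 2 := by
  obtain ⟨r, hr, rfl⟩ : ∃ r : ℝ, 0 < r ∧ lam1 = r * lam0 :=
    ⟨lam1 / lam0, by positivity, by field_simp⟩
  have h1 := variational_inequality_of_isMaxOn_dualObj C t hlam1 heta hα1_nonneg hα1
    (z := fun j => r * α0 j) fun j => mul_nonneg hr.le (hα0_nonneg j)
  have h0 := mul_nonpos_of_nonneg_of_nonpos hr.le
    (variational_inequality_of_isMaxOn_dualObj C t hlam0 heta hα0_nonneg hα0
      (z := fun j => r⁻¹ * α1 j) fun j => mul_nonneg (inv_nonneg.2 hr.le) (hα1_nonneg j))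
  have hmono := sum_nonneg fun k (_ : k ∈ univ) =>
    mLam_monotone C hlam1 heta (fun j => r * α0 j) α1 k
  simp only [mLam_mul_smul C hr, sub_mul, sum_sub_distrib] at hmono
  have hscale (j : Fin N) : r * (r⁻¹ * α1 j - α0 j) = -(r * α0 j - α1 j) := by
    field_simp
    ring
  rw [mul_sub] at h0
  simp only [mul_sum _ _ r, mul_left_comm r, hscale, mul_neg, sum_neg_distrib] at h0
  have hquad : ∑ j, (α1 j - (lam0 + r * lam0) / (2 * lam0) * α0 j) ^ 2
      - ∑ j, ((lam0 - r * lam0) / (2 * lam0) * α0 j) ^ 2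
      = 2 * (∑ j, (t j - α1 j / 2) * (r * α0 j - α1 j)
        - ∑ j, (t j - α0 j / 2) * (r * α0 j - α1 j)) := by
    simp only [mul_sum, ← sum_sub_distrib]
    refine sum_congr rfl fun j _ => ?_
    field_simp
    ring
  linarith
end

section
/- Relaxed regularization path bound (RRPB, Theorem 3): let λ₀ > 0 and λ₁ > 0, let α₀* be a maximizer of D_{λ₀} over the nonnegative orthant, let α₁* be a maximizer of D_{λ₁} over the nonnegative orthant, and suppose α₀ ∈ ℝ^N satisfies ‖α₀ − α₀*‖₂ ≤ ε. Then ‖α₁* − ((λ₀ + λ₁)/(2λ₀))·α₀‖₂ ≤ ‖((λ₀ − λ₁)/(2λ₀))·α₀‖₂ + ((λ₀ + λ₁)/(2λ₀) + |λ₀ − λ₁|/(2λ₀))·ε. -/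
open Finset

/-- The dual objective in the variable `β = α / λ`, divided by `λ` and with the quadratic term
`-(λ / 4) * ‖β‖ ^ 2` removed. It does not depend on `λ`. -/
noncomputable def scaledDual {p N : ℕ} (C : Matrix (Fin p) (Fin N) ℝ) (t : Fin N → ℝ)
    (eta : ℝ) (β : EuclideanSpace ℝ (Fin N)) : ℝ :=
  (∑ j, t j * β j) - 1 / (2 * eta) * ∑ k, max ((∑ j, C k j * β j) - 1) 0 ^ 2

lemma sum_mul_add_smul {N : ℕ} (c : Fin N → ℝ) (x y : EuclideanSpace ℝ (Fin N)) (a b : ℝ) :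
    ∑ j, c j * (a • x + b • y) j = a * ∑ j, c j * x j + b * ∑ j, c j * y j := by
  simp only [PiLp.add_apply, PiLp.smul_apply, smul_eq_mul, Finset.mul_sum,
    ← Finset.sum_add_distrib]
  exact Finset.sum_congr rfl fun j _ => by ring

lemma concaveOn_scaledDual {p N : ℕ} (C : Matrix (Fin p) (Fin N) ℝ) (t : Fin N → ℝ)
    {eta : ℝ} (heta : 0 < eta) : ConcaveOn ℝ Set.univ (scaledDual C t eta) := by
  refine ⟨convex_univ, fun x _ y _ a b ha hb hab => ?_⟩
  have hsq : ConvexOn ℝ Set.univ fun u : ℝ => max (u - 1) 0 ^ 2 := by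
    refine ConvexOn.pow (f := fun u : ℝ => max (u - 1) 0) ?_ (fun u _ => le_max_right _ _) 2
    exact (((convexOn_id convex_univ).add_const (-1)).congr fun u _ => (sub_eq_add_neg u 1).symm).sup
      (convexOn_const 0 convex_univ)
  have hsum : ∑ k, max ((∑ j, C k j * (a • x + b • y) j) - 1) 0 ^ 2
      ≤ a * ∑ k, max ((∑ j, C k j * x j) - 1) 0 ^ 2
        + b * ∑ k, max ((∑ j, C k j * y j) - 1) 0 ^ 2 := by
    rw [Finset.mul_sum, Finset.mul_sum, ← Finset.sum_add_distrib]
    refine Finset.sum_le_sum fun k _ => ?_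
    rw [sum_mul_add_smul]
    exact hsq.2 (Set.mem_univ _) (Set.mem_univ _) ha hb hab
  have h := mul_le_mul_of_nonneg_left hsum (by positivity : 0 ≤ 1 / (2 * eta))
  simp only [scaledDual, sum_mul_add_smul, smul_eq_mul] at h ⊢
  linarith

lemma dualObj_smul {p N : ℕ} (C : Matrix (Fin p) (Fin N) ℝ) (t : Fin N → ℝ)
    {lam eta : ℝ} (hlam : 0 < lam) (heta : 0 < eta) (β : EuclideanSpace ℝ (Fin N)) :
    dualObj C t lam eta (fun j => lam * β j)
      = lam * (scaledDual C t eta β - lam / 4 * ‖β‖ ^ 2) := by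
  have hm (k : Fin p) : mLam C lam eta (fun j => lam * β j) k
      = 1 / eta * max ((∑ j, C k j * β j) - 1) 0 := by
    have hC : (∑ j, C k j * (lam * β j)) - lam = lam * ((∑ j, C k j * β j) - 1) := by
      rw [mul_sub, Finset.mul_sum, mul_one]
      exact congrArg (· - lam) (Finset.sum_congr rfl fun j _ => by ring)
    have hmax := mul_max_of_nonneg ((∑ j, C k j * β j) - 1) 0 hlam.le
    rw [mul_zero] at hmax
    rw [mLam, hC, ← hmax]
    field_simp
  have ht : ∑ j, t j * (lam * β j) = lam * ∑ j, t j * β j := by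
    rw [Finset.mul_sum]
    exact Finset.sum_congr rfl fun j _ => by ring
  simp only [dualObj, hm, ht, scaledDual, EuclideanSpace.real_norm_sq_eq, mul_pow,
    ← Finset.mul_sum]
  field_simp
  ring

section InnerProductSpace

variable {E : Type*} [NormedAddCommGroup E] [InnerProductSpace ℝ E]

/-- First-order optimality condition for a concave function with a quadratic penalty. -/
lemma ConcaveOn.sub_le_inner_of_isMaxOn {s : Set E} {G : E → ℝ} {μ : ℝ} (hμ : 0 ≤ μ)
    (hG : ConcaveOn ℝ s G) {x y : E} (hx : x ∈ s) (hy : y ∈ s)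
    (hmax : IsMaxOn (fun z => G z - μ * ‖z‖ ^ 2) s x) :
    G y - G x ≤ 2 * μ * inner ℝ x (y - x) := by
  by_contra! hlt
  set δ := G y - G x - 2 * μ * inner ℝ x (y - x) with hδ
  have hδ0 : 0 < δ := by linarith
  set K := μ * ‖y - x‖ ^ 2 with hK
  have hK0 : 0 ≤ K := by positivity
  set r := δ / (δ + K) with hr
  have hr0 : 0 < r := by positivity
  have hr1 : r ≤ 1 := (div_le_one (by positivity)).2 (by linarith)
  have hconc := hG.2 hx hy (sub_nonneg.2 hr1) hr0.le (by ring)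
  have hle := isMaxOn_iff.1 hmax _ (hG.1 hx hy (sub_nonneg.2 hr1) hr0.le (by ring))
  have hcomb : (1 - r) • x + r • y = x + r • (y - x) := by module
  rw [hcomb] at hconc hle
  rw [norm_add_sq_real, norm_smul, inner_smul_right, Real.norm_of_nonneg hr0.le] at hle
  simp only [smul_eq_mul] at hconc
  have hrδ : r * δ ≤ r * (r * K) := by
    rw [hδ, hK]
    linarith
  have hδr : δ ≤ r * K := le_of_mul_le_mul_left hrδ hr0
  have hreq : r * (δ + K) = δ := div_mul_cancel₀ _ (by positivity)
  have := mul_pos hr0 hδ0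
  linarith

lemma norm_sub_smul_le_of_inner_nonpos {x y : E} {a b : ℝ} (ha : 0 < a)
    (h : inner ℝ (y - x) (a • y - b • x) ≤ 0) :
    ‖y - ((a + b) / (2 * a)) • x‖ ≤ |a - b| / (2 * a) * ‖x‖ := by
  refine le_of_sq_le_sq ?_ (by positivity)
  have hba : inner ℝ (y - x) (a • y - b • x)
      = a * ‖y‖ ^ 2 - (a + b) * inner ℝ y x + b * ‖x‖ ^ 2 := by
    simp only [inner_sub_left, inner_sub_right, inner_smul_right, real_inner_self_eq_norm_sq,
      real_inner_comm y x]
    ring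
  rw [norm_sub_sq_real, inner_smul_right, norm_smul, mul_pow, mul_pow, Real.norm_eq_abs, sq_abs,
    div_pow, div_pow, sq_abs]
  have key : (‖y‖ ^ 2 - 2 * ((a + b) / (2 * a) * inner ℝ y x)
      + (a + b) ^ 2 / (2 * a) ^ 2 * ‖x‖ ^ 2) - (a - b) ^ 2 / (2 * a) ^ 2 * ‖x‖ ^ 2
      = (a * ‖y‖ ^ 2 - (a + b) * inner ℝ y x + b * ‖x‖ ^ 2) / a := by
    field_simp
    ring
  have := div_nonpos_of_nonpos_of_nonneg (hba ▸ h) ha.le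
  linarith

/-- A ball bound around a multiple of `x` stays valid around a perturbation `x'` of `x`, at the
cost of enlarging the radius. -/
lemma norm_sub_smul_le_of_norm_sub_le {x x' y : E} {c d ε : ℝ} (hc : 0 ≤ c) (hd : 0 ≤ d)
    (h : ‖y - c • x‖ ≤ d * ‖x‖) (hx : ‖x' - x‖ ≤ ε) :
    ‖y - c • x'‖ ≤ d * ‖x'‖ + (c + d) * ε := by
  have hsplit : y - c • x' = (y - c • x) - c • (x' - x) := by module
  have hcε : ‖c • (x' - x)‖ ≤ c * ε := by
    rw [norm_smul, Real.norm_of_nonneg hc]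
    exact mul_le_mul_of_nonneg_left hx hc
  have hxx' : ‖x‖ ≤ ‖x'‖ + ε := by
    have := norm_sub_norm_le x x'
    rw [norm_sub_rev] at this
    linarith
  have htri := norm_sub_le (y - c • x) (c • (x' - x))
  have := mul_le_mul_of_nonneg_left hxx' hd
  rw [hsplit]
  linarith

end InnerProductSpace

/-- Optimality condition for the dual problem in the scaled variable. -/
lemma scaledDual_sub_le_inner {p N : ℕ} (C : Matrix (Fin p) (Fin N) ℝ) (t : Fin N → ℝ)
    {lam eta : ℝ} (hlam : 0 < lam) (heta : 0 < eta) {x y : EuclideanSpace ℝ (Fin N)}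
    (hx : ∀ j, 0 ≤ x j) (hy : ∀ j, 0 ≤ y j)
    (hmax : IsMaxOn (dualObj C t lam eta) {α | ∀ j, 0 ≤ α j} (lam • x).ofLp) :
    scaledDual C t eta y - scaledDual C t eta x ≤ lam / 2 * inner ℝ x (y - x) := by
  have hconv : Convex ℝ {z : EuclideanSpace ℝ (Fin N) | ∀ j, 0 ≤ z j} := by
    intro u hu v hv a b ha hb _ j
    exact add_nonneg (mul_nonneg ha (hu j)) (mul_nonneg hb (hv j))
  have h := ((concaveOn_scaledDual C t heta).subset (Set.subset_univ _)
    hconv).sub_le_inner_of_isMaxOn (μ := lam / 4) (by positivity) hx hy <|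
    isMaxOn_iff.2 fun z hz => by
      have hle : dualObj C t lam eta (fun j => lam * z j)
          ≤ dualObj C t lam eta (fun j => lam * x j) :=
        isMaxOn_iff.1 hmax _ fun j => mul_nonneg hlam.le (hz j)
      rw [dualObj_smul C t hlam heta, dualObj_smul C t hlam heta] at hle
      exact le_of_mul_le_mul_left hle hlam
  linarith

/-- Relaxed regularization path bound (RRPB, Theorem 3): if `α₀*` maximizes `D_{λ₀}`,
`α₁*` maximizes `D_{λ₁}` over the nonnegative orthant, and `‖α₀ − α₀*‖₂ ≤ ε`, then
`‖α₁* − ((λ₀+λ₁)/(2λ₀))·α₀‖₂ ≤ ‖((λ₀−λ₁)/(2λ₀))·α₀‖₂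
  + ((λ₀+λ₁)/(2λ₀) + |λ₀−λ₁|/(2λ₀))·ε`. -/
theorem igml_relaxed_regularization_path_bound {p N : ℕ} (hp : 0 < p) (hN : 0 < N)
    (C : Matrix (Fin p) (Fin N) ℝ) (t : Fin N → ℝ)
    (eta : ℝ) (heta : 0 < eta)
    (lam0 lam1 : ℝ) (hlam0 : 0 < lam0) (hlam1 : 0 < lam1)
    (α0star : Fin N → ℝ) (hα0star_nonneg : ∀ j, 0 ≤ α0star j)
    (hα0star : IsMaxOn (dualObj C t lam0 eta) {α | ∀ j, 0 ≤ α j} α0star)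
    (α1star : Fin N → ℝ) (hα1star_nonneg : ∀ j, 0 ≤ α1star j)
    (hα1star : IsMaxOn (dualObj C t lam1 eta) {α | ∀ j, 0 ≤ α j} α1star)
    (α0 : Fin N → ℝ) (ε : ℝ)
    (hε : Real.sqrt (∑ j, (α0 j - α0star j) ^ 2) ≤ ε) :
    Real.sqrt (∑ j, (α1star j - (lam0 + lam1) / (2 * lam0) * α0 j) ^ 2)
      ≤ Real.sqrt (∑ j, ((lam0 - lam1) / (2 * lam0) * α0 j) ^ 2)
        + ((lam0 + lam1) / (2 * lam0) + |lam0 - lam1| / (2 * lam0)) * ε := by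
  set x := WithLp.toLp 2 α0star with hx
  set y := WithLp.toLp 2 α1star
  set x' := WithLp.toLp 2 α0 with hx'
  have hx_smul : lam0 • lam0⁻¹ • x = x := smul_inv_smul₀ hlam0.ne' x
  have hy_smul : lam1 • lam1⁻¹ • y = y := smul_inv_smul₀ hlam1.ne' y
  have hx_nonneg : ∀ j, 0 ≤ (lam0⁻¹ • x) j := fun j =>
    mul_nonneg (inv_nonneg.2 hlam0.le) (hα0star_nonneg j)
  have hy_nonneg : ∀ j, 0 ≤ (lam1⁻¹ • y) j := fun j =>
    mul_nonneg (inv_nonneg.2 hlam1.le) (hα1star_nonneg j)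
  have hopt0 := scaledDual_sub_le_inner C t hlam0 heta hx_nonneg hy_nonneg
    (by rw [hx_smul]; exact hα0star)
  have hopt1 := scaledDual_sub_le_inner C t hlam1 heta hy_nonneg hx_nonneg
    (by rw [hy_smul]; exact hα1star)
  have hinner : inner ℝ (y - x) (lam0 • y - lam1 • x) ≤ 0 := by
    have hsum : inner ℝ (y - x) (lam0 • y - lam1 • x)
        = -(2 * lam0 * lam1) * (lam0 / 2 * inner ℝ (lam0⁻¹ • x) (lam1⁻¹ • y - lam0⁻¹ • x)
          + lam1 / 2 * inner ℝ (lam1⁻¹ • y) (lam0⁻¹ • x - lam1⁻¹ • y)) := by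
      simp only [inner_sub_left, inner_sub_right, inner_smul_left, inner_smul_right,
        real_inner_comm y x, conj_trivial]
      field_simp
      ring
    rw [hsum]
    exact mul_nonpos_of_nonpos_of_nonneg (by linarith [mul_pos hlam0 hlam1]) (by linarith)
  have hε' : ‖x' - x‖ ≤ ε := by
    simpa [EuclideanSpace.norm_eq, hx, hx', sq_abs] using hε
  have h := norm_sub_smul_le_of_norm_sub_le (by positivity) (by positivity)
    (norm_sub_smul_le_of_inner_nonpos hlam0 hinner) hε'
  have hnorm : |lam0 - lam1| / (2 * lam0) * ‖x'‖ = ‖((lam0 - lam1) / (2 * lam0)) • x'‖ := by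
    rw [norm_smul, Real.norm_eq_abs, abs_div, abs_of_pos (by positivity : 0 < 2 * lam0)]
  rw [hnorm] at h
  simpa only [EuclideanSpace.norm_eq, Real.norm_eq_abs, sq_abs, PiLp.sub_apply, PiLp.smul_apply,
    smul_eq_mul] using h
end

section
/- Safe screening rule (Theorem 4): suppose α* is a maximizer of D_λ over the nonnegative orthant and α* lies in the ball {α : ‖α − q‖₂ ≤ r} for some q ∈ ℝ^N and r ≥ 0. If C_{k,:} q + r·‖C_{k,:}‖₂ ≤ λ for a feature index k, then (m_λ(α*))_k = 0. -/
open Finset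

/-- If `a` lies in the Euclidean ball of centre `q` and radius `r`, then `⟨c, a⟩` is at most
`⟨c, q⟩ + r * ‖c‖₂`. -/
theorem sum_mul_le_of_sqrt_sum_sq_sub_le {ι : Type*} [Fintype ι] (c a q : ι → ℝ) {r : ℝ}
    (h : Real.sqrt (∑ j, (a j - q j) ^ 2) ≤ r) :
    ∑ j, c j * a j ≤ (∑ j, c j * q j) + r * Real.sqrt (∑ j, c j ^ 2) :=
  calc ∑ j, c j * a j = (∑ j, c j * q j) + ∑ j, (a j - q j) * c j := by
        rw [← Finset.sum_add_distrib]
        exact Finset.sum_congr rfl fun j _ => by ring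
    _ ≤ (∑ j, c j * q j) + Real.sqrt (∑ j, (a j - q j) ^ 2) * Real.sqrt (∑ j, c j ^ 2) := by
        gcongr
        exact Real.sum_mul_le_sqrt_mul_sqrt _ _ _
    _ ≤ (∑ j, c j * q j) + r * Real.sqrt (∑ j, c j ^ 2) := by gcongr

/-- Safe screening rule (Theorem 4): if the dual maximizer `α*` lies in the ball
`{α : ‖α − q‖₂ ≤ r}` and `C_{k,:} q + r·‖C_{k,:}‖₂ ≤ λ`, then `(m_λ(α*))_k = 0`. -/
theorem igml_safe_screening {p N : ℕ} (hp : 0 < p) (hN : 0 < N)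
    (C : Matrix (Fin p) (Fin N) ℝ) (t : Fin N → ℝ)
    (lam eta : ℝ) (hlam : 0 < lam) (heta : 0 < eta)
    (αstar : Fin N → ℝ) (hstar_nonneg : ∀ j, 0 ≤ αstar j)
    (hstar : IsMaxOn (dualObj C t lam eta) {α | ∀ j, 0 ≤ α j} αstar)
    (q : Fin N → ℝ) (r : ℝ) (hr : 0 ≤ r)
    (hball : Real.sqrt (∑ j, (αstar j - q j) ^ 2) ≤ r)
    (k : Fin p)
    (hrule : (∑ j, C k j * q j) + r * Real.sqrt (∑ j, C k j ^ 2) ≤ lam) :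
    mLam C lam eta αstar k = 0 := by
  have h := (sum_mul_le_of_sqrt_sum_sq_sub_le (C k) αstar q hball).trans hrule
  simp only [mLam, max_eq_right (sub_nonpos.mpr h), mul_zero]
end

section
/- Safe pruning rule (Theorem 5): suppose α* is a maximizer of D_λ over the nonnegative orthant and α* lies in the ball {α : ‖α − q‖₂ ≤ r} with q ∈ ℝ^N, q ≥ 0, and r ≥ 0. If Prune(k | q, r) ≤ λ for a feature index k, then (m_λ(α*))_{k′} = 0 for every descendant k′ of k. -/
open Finset

/-- A difference of two numbers of `[0, u]` and `[0, v]` has square at most `max u v ^ 2`. -/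
lemma sq_sub_le_max_sq {c d u v : ℝ} (hc : 0 ≤ c) (hd : 0 ≤ d) (hcu : c ≤ u) (hdv : d ≤ v) :
    (c - d) ^ 2 ≤ max u v ^ 2 := by
  refine sq_le_sq' ?_ ?_
  · linarith [le_max_right u v]
  · linarith [le_max_left u v]

/-- For nonnegative features, `(Cα)_{k'}` is bounded by the pruning criterion of any feature
dominating `k'`, for every nonnegative `α` in the ball of radius `r` around `q`. -/
lemma sum_pairC_mul_le_prune {n p N : ℕ} {x : Fin n → Fin p → ℝ} (hx : ∀ i k, 0 ≤ x i k)
    {sgn : Fin N → ℝ} (hsgn : ∀ j, sgn j = 1 ∨ sgn j = -1) (a b : Fin N → Fin n)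
    {α q : Fin N → ℝ} (hα : ∀ j, 0 ≤ α j) {r : ℝ}
    (hball : Real.sqrt (∑ j, (α j - q j) ^ 2) ≤ r) {k k' : Fin p}
    (hk' : ∀ i, x i k' ≤ x i k) :
    ∑ j, pairC x sgn a b k' j * α j ≤ prune x sgn a b k q r := by
  set M : Fin N → ℝ := fun j => max (x (a j) k) (x (b j) k) ^ 2 with hM
  have hMnn : ∀ j, 0 ≤ M j := fun j => sq_nonneg _
  have hterm : ∀ j, pairC x sgn a b k' j * α j ≤
      (if sgn j = 1 then q j * M j else 0) + |α j - q j| * M j := by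
    intro j
    have hdiff : (x (a j) k' - x (b j) k') ^ 2 ≤ M j :=
      sq_sub_le_max_sq (hx _ _) (hx _ _) (hk' _) (hk' _)
    rcases hsgn j with h | h
    · simp only [pairC, h, if_true, one_mul]
      calc (x (a j) k' - x (b j) k') ^ 2 * α j ≤ M j * α j :=
            mul_le_mul_of_nonneg_right hdiff (hα j)
        _ = q j * M j + (α j - q j) * M j := by ring
        _ ≤ q j * M j + |α j - q j| * M j := by
            gcongr
            · exact le_abs_self _
    · have hne : ¬ ((-1 : ℝ) = 1) := by norm_num
      simp only [pairC, h, if_neg hne, zero_add]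
      have h₁ : 0 ≤ (x (a j) k' - x (b j) k') ^ 2 * α j := mul_nonneg (sq_nonneg _) (hα j)
      have h₂ : 0 ≤ |α j - q j| * M j := mul_nonneg (abs_nonneg _) (hMnn j)
      linarith
  have hcs : ∑ j, |α j - q j| * M j ≤
      r * Real.sqrt (∑ j, max (x (a j) k) (x (b j) k) ^ 4) := by
    refine (Real.sum_mul_le_sqrt_mul_sqrt _ _ _).trans ?_
    simp only [sq_abs, hM, ← pow_mul]
    exact mul_le_mul_of_nonneg_right hball (Real.sqrt_nonneg _)
  calc ∑ j, pairC x sgn a b k' j * α j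
      ≤ ∑ j, ((if sgn j = 1 then q j * M j else 0) + |α j - q j| * M j) :=
        Finset.sum_le_sum fun j _ => hterm j
    _ = (∑ j ∈ Finset.univ.filter (fun j => sgn j = 1), q j * M j)
          + ∑ j, |α j - q j| * M j := by
        rw [Finset.sum_add_distrib, Finset.sum_filter]
    _ ≤ prune x sgn a b k q r := by
        unfold prune
        gcongr

/-- Safe pruning rule (Theorem 5): if the dual maximizer `α*` lies in the ball
`{α : ‖α − q‖₂ ≤ r}` with `q ≥ 0`, `r ≥ 0`, and `Prune(k | q, r) ≤ λ`, then
`(m_λ(α*))_{k′} = 0` for every descendant `k′` of `k`. -/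
theorem igml_safe_pruning {n p N : ℕ}
    (x : Fin n → Fin p → ℝ) (hx : ∀ i k, 0 ≤ x i k)
    (sgn : Fin N → ℝ) (hsgn : ∀ j, sgn j = 1 ∨ sgn j = -1)
    (a b : Fin N → Fin n) (t : Fin N → ℝ)
    (lam eta : ℝ) (hlam : 0 < lam) (heta : 0 < eta)
    (αstar : Fin N → ℝ) (hstar_nonneg : ∀ j, 0 ≤ αstar j)
    (hstar : IsMaxOn (dualObj (pairC x sgn a b) t lam eta) {α | ∀ j, 0 ≤ α j} αstar)
    (q : Fin N → ℝ) (hq : ∀ j, 0 ≤ q j) (r : ℝ) (hr : 0 ≤ r)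
    (hball : Real.sqrt (∑ j, (αstar j - q j) ^ 2) ≤ r)
    (k : Fin p) (hrule : prune x sgn a b k q r ≤ lam) :
    ∀ k' : Fin p, (∀ i, x i k' ≤ x i k) →
      mLam (pairC x sgn a b) lam eta αstar k' = 0 := by
  intro k' hk'
  have hle := (sum_pairC_mul_le_prune hx hsgn a b hstar_nonneg hball hk').trans hrule
  simp only [mLam]
  rw [max_eq_right (sub_nonpos.mpr hle), mul_zero]
end

section
/- Range-based safe screening (RSS, Theorem 6): let λ₀ > 0, let α₀* be a maximizer of D_{λ₀} over the nonnegative orthant, and let α₀ ≥ 0 satisfy ‖α₀ − α₀*‖₂ ≤ ε. For a feature index k define λ_a := λ₀·(2ε‖C_{k,:}‖₂ + ‖α₀‖₂‖C_{k,:}‖₂ + C_{k,:}α₀) / (2λ₀ + ‖α₀‖₂‖C_{k,:}‖₂ − C_{k,:}α₀). Then for every λ with λ_a ≤ λ ≤ λ₀ and every maximizer α_λ* of D_λ over the nonnegative orthant, (m_λ(α_λ*))_k = 0. -/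
open Finset

lemma sq_mul_max_le {c : ℝ} (x y : ℝ) :
    (c * max (x + y) 0) ^ 2 ≤ (c * max x 0) ^ 2 + 2 * c * y * (c * max x 0) + (c * y) ^ 2 := by
  have h : max (x + y) 0 ^ 2 ≤ max x 0 ^ 2 + 2 * y * max x 0 + y ^ 2 := by
    rcases max_cases (x + y) 0 with ⟨h1, h2⟩ | ⟨h1, h2⟩ <;>
      rcases max_cases x 0 with ⟨h3, h4⟩ | ⟨h3, h4⟩ <;> rw [h1, h3] <;>
      nlinarith [sq_nonneg (x + y)]
  nlinarith [mul_le_mul_of_nonneg_left h (sq_nonneg c)]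

lemma nonpos_of_forall_mul_le_sq_mul {r G K : ℝ} (hr : 0 < r)
    (h : ∀ s, 0 < s → s ≤ r → s * G ≤ s ^ 2 * K) : G ≤ 0 := by
  by_contra! hG
  have hK : 0 < |K| + 1 := by positivity
  set s := min r (G / (2 * (|K| + 1))) with hs
  have hs0 : 0 < s := lt_min hr (by positivity)
  have h2 : s * (2 * (|K| + 1)) ≤ G := (le_div_iff₀ (by positivity)).1 (min_le_right _ _)
  have h3 : s * G ≤ s * (s * K) := by linarith [h s hs0 (min_le_left _ _)]
  nlinarith [le_of_mul_le_mul_left h3 hs0, le_abs_self K]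

/-- First-order optimality condition: the directional derivative of the dual objective at a
maximizer over the nonnegative orthant is nonpositive along every feasible direction. -/
lemma dualObj_dirDeriv_nonpos {p N : ℕ} {C : Matrix (Fin p) (Fin N) ℝ} {t : Fin N → ℝ}
    {lam eta : ℝ} (hlam : 0 < lam) (heta : 0 < eta) {α : Fin N → ℝ} (hα : ∀ j, 0 ≤ α j)
    (hmax : IsMaxOn (dualObj C t lam eta) {α | ∀ j, 0 ≤ α j} α)
    {d : Fin N → ℝ} {r : ℝ} (hr : 0 < r) (hd : ∀ j, 0 ≤ α j + r * d j) :
    -(1 / 2) * (∑ j, α j * d j) + (∑ j, t j * d j)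
      - ∑ k, mLam C lam eta α k * ∑ j, C k j * d j ≤ 0 := by
  apply nonpos_of_forall_mul_le_sq_mul (K := (1 / 4) * (∑ j, d j ^ 2)
    + lam * eta / 2 * ∑ k, (1 / (lam * eta) * ∑ j, C k j * d j) ^ 2) hr
  intro s hs hsr
  have hfeas : ∀ j, 0 ≤ α j + s * d j := by
    intro j
    rcases le_total 0 (d j) with h | h
    · have := mul_nonneg hs.le h
      linarith [hα j]
    · nlinarith [hd j]
  have hle : dualObj C t lam eta (fun j => α j + s * d j) ≤ dualObj C t lam eta α := hmax hfeas
  have hm : ∑ k, mLam C lam eta (fun j => α j + s * d j) k ^ 2 ≤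
      ∑ k, mLam C lam eta α k ^ 2
        + 2 * s / (lam * eta) * ∑ k, mLam C lam eta α k * ∑ j, C k j * d j
        + s ^ 2 * ∑ k, (1 / (lam * eta) * ∑ j, C k j * d j) ^ 2 := by
    rw [mul_sum, mul_sum, ← sum_add_distrib, ← sum_add_distrib]
    refine sum_le_sum fun k _ => ?_
    have he : (∑ j, C k j * (α j + s * d j)) - lam
        = ((∑ j, C k j * α j) - lam) + s * ∑ j, C k j * d j := by
      simp only [mul_add, sum_add_distrib, mul_sum]
      simp only [mul_left_comm s]
      ring
    simp only [mLam, he]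
    refine (sq_mul_max_le _ _).trans (le_of_eq ?_)
    ring
  have h1 : ∑ j, (α j + s * d j) ^ 2
      = ∑ j, α j ^ 2 + 2 * s * ∑ j, α j * d j + s ^ 2 * ∑ j, d j ^ 2 := by
    rw [mul_sum, mul_sum, ← sum_add_distrib, ← sum_add_distrib]
    exact sum_congr rfl fun j _ => by ring
  have h2 : ∑ j, t j * (α j + s * d j) = ∑ j, t j * α j + s * ∑ j, t j * d j := by
    rw [mul_sum, ← sum_add_distrib]
    exact sum_congr rfl fun j _ => by ring
  have hm' := mul_le_mul_of_nonneg_left hm (by positivity : 0 ≤ lam * eta / 2)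
  have hc : ∀ x, lam * eta / 2 * (2 * s / (lam * eta) * x) = s * x := fun x => by
    field_simp
  rw [mul_add, mul_add, hc] at hm'
  simp only [dualObj, h1, h2] at hle
  linarith

lemma mLam_sub_mul_nonneg {p N : ℕ} (C : Matrix (Fin p) (Fin N) ℝ) {lam lam0 eta : ℝ}
    (hlam : 0 < lam) (hlam0 : 0 < lam0) (heta : 0 < eta) (α α0 : Fin N → ℝ) (k : Fin p) :
    0 ≤ (mLam C lam0 eta α0 k - mLam C lam eta α k)
      * ∑ j, C k j * (lam * α0 j - lam0 * α j) := by
  have he : ∑ j, C k j * (lam * α0 j - lam0 * α j)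
      = lam * lam0 * ((∑ j, C k j * α0 j) / lam0 - (∑ j, C k j * α j) / lam) := by
    have : ∑ j, C k j * (lam * α0 j - lam0 * α j)
        = lam * ∑ j, C k j * α0 j - lam0 * ∑ j, C k j * α j := by
      rw [mul_sum, mul_sum, ← sum_sub_distrib]
      exact sum_congr rfl fun j _ => by ring
    rw [this]
    field_simp
  have hm : ∀ (l : ℝ) (β : Fin N → ℝ), 0 < l →
      mLam C l eta β k = 1 / eta * max ((∑ j, C k j * β j) / l - 1) 0 := by
    intro l β hl
    have : (∑ j, C k j * β j) - l = l * ((∑ j, C k j * β j) / l - 1) := by field_simp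
    have hmax : max (l * ((∑ j, C k j * β j) / l - 1)) 0
        = l * max ((∑ j, C k j * β j) / l - 1) 0 := by
      rw [mul_max_of_nonneg _ _ hl.le, mul_zero]
    rw [mLam, this, hmax]
    field_simp
  rw [he, hm _ _ hlam, hm _ _ hlam0, ← mul_sub]
  generalize (∑ j, C k j * α0 j) / lam0 = x
  generalize (∑ j, C k j * α j) / lam = y
  have hxy : 0 ≤ (max (x - 1) 0 - max (y - 1) 0) * (x - y) := by
    rcases le_total x y with h | h
    · exact mul_nonneg_of_nonpos_of_nonpos
        (sub_nonpos.2 (max_le_max_right _ (by linarith))) (by linarith)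
    · exact mul_nonneg (sub_nonneg.2 (max_le_max_right _ (by linarith))) (by linarith)
  calc 0 ≤ (1 / eta * (lam * lam0)) * ((max (x - 1) 0 - max (y - 1) 0) * (x - y)) := by
        positivity
    _ = _ := by ring

/-- The maximizers for two regularization parameters satisfy the sphere condition
`⟪α₀ - α, lam • α₀ - lam0 • α⟫ ≤ 0`. -/
lemma sum_sub_mul_sub_nonpos_of_isMaxOn {p N : ℕ} {C : Matrix (Fin p) (Fin N) ℝ}
    {t : Fin N → ℝ} {lam lam0 eta : ℝ} (hlam : 0 < lam) (hlam0 : 0 < lam0) (heta : 0 < eta)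
    {α α0 : Fin N → ℝ} (hα : ∀ j, 0 ≤ α j) (hα0 : ∀ j, 0 ≤ α0 j)
    (hmax : IsMaxOn (dualObj C t lam eta) {α | ∀ j, 0 ≤ α j} α)
    (hmax0 : IsMaxOn (dualObj C t lam0 eta) {α | ∀ j, 0 ≤ α j} α0) :
    ∑ j, (α0 j - α j) * (lam * α0 j - lam0 * α j) ≤ 0 := by
  have h := dualObj_dirDeriv_nonpos hlam heta hα hmax
    (d := fun j => lam * α0 j - lam0 * α j) (inv_pos.2 hlam0) fun j => by
      have : α j + lam0⁻¹ * (lam * α0 j - lam0 * α j) = lam0⁻¹ * (lam * α0 j) := by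
        field_simp; ring
      rw [this]
      have := hα0 j
      positivity
  have h0 := dualObj_dirDeriv_nonpos hlam0 heta hα0 hmax0
    (d := fun j => -(lam * α0 j - lam0 * α j)) (inv_pos.2 hlam) fun j => by
      have : α0 j + lam⁻¹ * -(lam * α0 j - lam0 * α j) = lam⁻¹ * (lam0 * α j) := by
        field_simp; ring
      rw [this]
      have := hα j
      positivity
  have hmono := sum_nonneg fun k (_ : k ∈ univ) =>
    mLam_sub_mul_nonneg C hlam hlam0 heta α α0 k
  simp only [sub_mul, sum_sub_distrib] at hmono ⊢
  simp only [mul_neg, sum_neg_distrib] at h0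
  linarith

lemma sqrt_sum_sq_le_add {N : ℕ} (x y : Fin N → ℝ) :
    √(∑ j, y j ^ 2) ≤ √(∑ j, x j ^ 2) + √(∑ j, (x j - y j) ^ 2) := by
  have h := Real.sum_mul_le_sqrt_mul_sqrt univ (fun j => -x j) (fun j => x j - y j)
  simp only [neg_sq] at h
  have he : ∑ j, y j ^ 2
      = ∑ j, x j ^ 2 + 2 * ∑ j, -x j * (x j - y j) + ∑ j, (x j - y j) ^ 2 := by
    rw [mul_sum, ← sum_add_distrib, ← sum_add_distrib]
    exact sum_congr rfl fun j _ => by ring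
  have hx : 0 ≤ ∑ j, x j ^ 2 := sum_nonneg fun _ _ => sq_nonneg _
  have hxy : 0 ≤ ∑ j, (x j - y j) ^ 2 := sum_nonneg fun _ _ => sq_nonneg _
  refine Real.sqrt_le_iff.2 ⟨by positivity, ?_⟩
  rw [he, add_sq, Real.sq_sqrt hx, Real.sq_sqrt hxy]
  linarith

/-- Range-based safe screening (RSS, Theorem 6): with `α₀* ` a maximizer of `D_{λ₀}`
over the nonnegative orthant, `α₀ ≥ 0` with `‖α₀ − α₀*‖₂ ≤ ε`, and
`λ_a := λ₀(2ε‖C_{k,:}‖ + ‖α₀‖‖C_{k,:}‖ + C_{k,:}α₀)/(2λ₀ + ‖α₀‖‖C_{k,:}‖ − C_{k,:}α₀)`,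
for every `λ` with `λ_a ≤ λ ≤ λ₀` and every maximizer `α_λ*` of `D_λ` over the
nonnegative orthant, `(m_λ(α_λ*))_k = 0`. -/
theorem igml_range_safe_screening {p N : ℕ} (hp : 0 < p) (hN : 0 < N)
    (C : Matrix (Fin p) (Fin N) ℝ) (t : Fin N → ℝ)
    (eta : ℝ) (heta : 0 < eta)
    (lam0 : ℝ) (hlam0 : 0 < lam0)
    (α0star : Fin N → ℝ) (hα0star_nonneg : ∀ j, 0 ≤ α0star j)
    (hα0star : IsMaxOn (dualObj C t lam0 eta) {α | ∀ j, 0 ≤ α j} α0star)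
    (α0 : Fin N → ℝ) (hα0_nonneg : ∀ j, 0 ≤ α0 j) (ε : ℝ)
    (hε : Real.sqrt (∑ j, (α0 j - α0star j) ^ 2) ≤ ε)
    (k : Fin p) :
    ∀ lam : ℝ, 0 < lam →
      lam0 * (2 * ε * Real.sqrt (∑ j, C k j ^ 2)
            + Real.sqrt (∑ j, α0 j ^ 2) * Real.sqrt (∑ j, C k j ^ 2)
            + ∑ j, C k j * α0 j)
          / (2 * lam0 + Real.sqrt (∑ j, α0 j ^ 2) * Real.sqrt (∑ j, C k j ^ 2)
            - ∑ j, C k j * α0 j) ≤ lam →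
      lam ≤ lam0 →
      ∀ αlamstar : Fin N → ℝ, (∀ j, 0 ≤ αlamstar j) →
        IsMaxOn (dualObj C t lam eta) {α | ∀ j, 0 ≤ α j} αlamstar →
        mLam C lam eta αlamstar k = 0 := by
  intro lam hlam hla hle α hα hmax
  have hsphere := sum_sub_mul_sub_nonpos_of_isMaxOn hlam hlam0 heta hα hα0star_nonneg hmax hα0star
  have hCα0 := Real.sum_mul_le_sqrt_mul_sqrt univ (C k) α0
  have hCdiff := Real.sum_mul_le_sqrt_mul_sqrt univ (C k) (fun j => α0star j - α0 j)
  have hCq := Real.sum_mul_le_sqrt_mul_sqrt univ (C k)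
    (fun j => 2 * lam0 * α j - (lam0 + lam) * α0star j)
  have htri := sqrt_sum_sq_le_add α0 α0star
  have hq : √(∑ j, (2 * lam0 * α j - (lam0 + lam) * α0star j) ^ 2)
      ≤ (lam0 - lam) * √(∑ j, α0star j ^ 2) := by
    refine Real.sqrt_le_iff.2 ⟨mul_nonneg (by linarith) (Real.sqrt_nonneg _), ?_⟩
    rw [mul_pow, Real.sq_sqrt (sum_nonneg fun _ _ => sq_nonneg _)]
    have he : ∑ j, (2 * lam0 * α j - (lam0 + lam) * α0star j) ^ 2
        = (lam0 - lam) ^ 2 * ∑ j, α0star j ^ 2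
          + 4 * lam0 * ∑ j, (α0star j - α j) * (lam * α0star j - lam0 * α j) := by
      rw [mul_sum, mul_sum, ← sum_add_distrib]
      exact sum_congr rfl fun j _ => by ring
    rw [he]
    linarith [mul_nonpos_of_nonneg_of_nonpos (by positivity : 0 ≤ 4 * lam0) hsphere]
  have hCq_eq : ∑ j, C k j * (2 * lam0 * α j - (lam0 + lam) * α0star j)
      = 2 * lam0 * ∑ j, C k j * α j - (lam0 + lam) * ∑ j, C k j * α0star j := by
    rw [mul_sum, mul_sum, ← sum_sub_distrib]
    exact sum_congr rfl fun j _ => by ring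
  have hdiff_comm : ∑ j, (α0star j - α0 j) ^ 2 = ∑ j, (α0 j - α0star j) ^ 2 :=
    sum_congr rfl fun j _ => by ring
  rw [hCq_eq] at hCq
  rw [hdiff_comm] at hCdiff
  simp only [mul_sub, sum_sub_distrib] at hCdiff
  have hc : 0 ≤ √(∑ j, C k j ^ 2) := Real.sqrt_nonneg _
  generalize √(∑ j, C k j ^ 2) = c at *
  generalize √(∑ j, α0 j ^ 2) = a at *
  generalize √(∑ j, α0star j ^ 2) = b at *
  rw [div_le_iff₀ (by linarith)] at hla
  have hb : c * √(∑ j, (2 * lam0 * α j - (lam0 + lam) * α0star j) ^ 2)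
      ≤ c * ((lam0 - lam) * (a + ε)) :=
    mul_le_mul_of_nonneg_left
      (hq.trans (mul_le_mul_of_nonneg_left (by linarith) (by linarith))) hc
  have hs : (lam0 + lam) * ∑ j, C k j * α0star j
      ≤ (lam0 + lam) * ((∑ j, C k j * α0 j) + c * ε) :=
    mul_le_mul_of_nonneg_left
      (by linarith [mul_le_mul_of_nonneg_left hε hc]) (by linarith)
  have hfinal : 2 * lam0 * ∑ j, C k j * α j ≤ 2 * lam0 * lam := by linarith
  have := le_of_mul_le_mul_left hfinal (by positivity)
  simp [mLam, max_eq_right (sub_nonpos.2 this)]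
end

section
/- Convergence of the working set method (Theorem 9): let 𝒟 ⊆ ℝ^d be convex, let f : ℝ^d → ℝ be differentiable and γ-strongly convex with γ > 0, and let h_1, …, h_n : ℝ^d → ℝ be convex. Assume the full feasible set {x ∈ 𝒟 : h_i(x) ≤ 0 for all i ∈ {1,…,n}} is nonempty. Let (x_t)_{t≥0} be a sequence with x_0 ∈ 𝒟 such that for each t ≥ 1, x_t is a minimizer of f over {x ∈ 𝒟 : h_j(x) ≤ 0 for all j ∈ W_t}, where W_t := {j : h_j(x_{t−1}) ≥ 0} (assume each such minimizer exists). Then there exists a finite T such that x_T is a minimizer of f over the full feasible set {x ∈ 𝒟 : h_i(x) ≤ 0 for all i ∈ {1,…,n}}. -/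
open scoped RealInnerProductSpace

open Filter Topology in
/-- Dropping from a family of convex constraints those that are strictly satisfied at a
minimizer `a` of a strictly convex function, every other point `b` that satisfies the
remaining constraints has a strictly larger value. -/
theorem StrictConvexOn.lt_of_isMinOn_of_active {E ι : Type*} [AddCommGroup E] [Module ℝ E]
    [Finite ι] {D : Set E} (hD : Convex ℝ D) {f : E → ℝ} (hf : StrictConvexOn ℝ Set.univ f)
    {h : ι → E → ℝ} (hh : ∀ i, ConvexOn ℝ Set.univ (h i)) {W : Set ι} {a b : E}
    (ha : a ∈ D) (haW : ∀ j ∈ W, h j a ≤ 0)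
    (hmin : IsMinOn f {y ∈ D | ∀ j ∈ W, h j y ≤ 0} a)
    (hb : b ∈ D) (hbW : ∀ j, 0 ≤ h j a → h j b ≤ 0) (hab : a ≠ b) : f a < f b := by
  have key : ∀ᶠ s : ℝ in 𝓝[>] 0, ∀ j, h j a < 0 → (1 - s) * h j a + s * h j b < 0 := by
    refine eventually_all.2 fun j => ?_
    by_cases hj : h j a < 0
    · have hc : Continuous fun s : ℝ => (1 - s) * h j a + s * h j b := by fun_prop
      have hs : ∀ᶠ s : ℝ in 𝓝 0, (1 - s) * h j a + s * h j b < 0 :=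
        hc.continuousAt.eventually_lt continuousAt_const (by simpa using hj)
      exact (hs.filter_mono nhdsWithin_le_nhds).mono fun s hs _ => hs
    · exact Eventually.of_forall fun s hj' => absurd hj' hj
  obtain ⟨s, hs, hs0, hs1⟩ :=
    (key.and (Ioo_mem_nhdsGT (zero_lt_one : (0 : ℝ) < 1))).exists
  have hs1' : 0 < 1 - s := sub_pos.2 hs1
  have hz : (1 - s) • a + s • b ∈ {y ∈ D | ∀ j ∈ W, h j y ≤ 0} := by
    refine ⟨hD ha hb hs1'.le hs0.le (by ring), fun j hj => ?_⟩
    have hle := (hh j).2 (Set.mem_univ a) (Set.mem_univ b) hs1'.le hs0.le (by ring)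
    simp only [smul_eq_mul] at hle
    rcases (haW j hj).lt_or_eq with hlt | heq
    · exact hle.trans (hs j hlt).le
    · have := hbW j heq.ge
      rw [heq] at hle
      nlinarith
  have hfz : f a ≤ f ((1 - s) • a + s • b) := hmin hz
  have hlt := hf.2 (Set.mem_univ a) (Set.mem_univ b) hab hs1' hs0 (by ring)
  simp only [smul_eq_mul] at hlt
  nlinarith

/-- The first-order strong convexity inequality implies strict convexity. -/
theorem strictConvexOn_of_forall_add_inner_add_le {E : Type*} [NormedAddCommGroup E]
    [InnerProductSpace ℝ E] {f : E → ℝ} {g : E → E} {γ : ℝ} (hγ : 0 < γ)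
    (hfg : ∀ x y, f x + ⟪g x, y - x⟫ + γ / 2 * ‖y - x‖ ^ 2 ≤ f y) :
    StrictConvexOn ℝ Set.univ f := by
  refine ⟨convex_univ, fun x _ y _ hxy a b ha hb hab => ?_⟩
  obtain rfl : a = 1 - b := by linarith
  simp only [smul_eq_mul]
  set z := (1 - b) • x + b • y with hz
  have hx : x - z = (-b) • (y - x) := by rw [hz]; module
  have hy : y - z = (1 - b) • (y - x) := by rw [hz]; module
  have h₁ := hfg z x
  have h₂ := hfg z y
  rw [hx, inner_smul_right, norm_smul, mul_pow, Real.norm_eq_abs, sq_abs] at h₁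
  rw [hy, inner_smul_right, norm_smul, mul_pow, Real.norm_eq_abs, sq_abs] at h₂
  have hpos : 0 < ‖y - x‖ ^ 2 := pow_pos (norm_pos_iff.2 (sub_ne_zero.2 hxy.symm)) 2
  have hq : 0 < (1 - b) * b * (γ / 2 * ‖y - x‖ ^ 2) := by positivity
  have h₃ := mul_le_mul_of_nonneg_left h₁ ha.le
  have h₄ := mul_le_mul_of_nonneg_left h₂ hb.le
  linear_combination h₃ + h₄ + hq

/-- Convergence of the working set method (Theorem 9): iteratively minimizing a
`γ`-strongly convex differentiable `f` over the constraints `W_t` that are violated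
or active at the previous iterate reaches, in finitely many steps, a minimizer of
`f` over the full feasible set. -/
theorem working_set_convergence {d n : ℕ}
    (𝒟 : Set (EuclideanSpace ℝ (Fin d))) (h𝒟 : Convex ℝ 𝒟)
    (f : EuclideanSpace ℝ (Fin d) → ℝ) (hf : Differentiable ℝ f)
    (γ : ℝ) (hγ : 0 < γ)
    (hstrong : ∀ x y : EuclideanSpace ℝ (Fin d),
      f x + ⟪gradient f x, y - x⟫ + γ / 2 * ‖y - x‖ ^ 2 ≤ f y)
    (h : Fin n → EuclideanSpace ℝ (Fin d) → ℝ)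
    (hconv : ∀ i, ConvexOn ℝ Set.univ (h i))
    (hfeas : ({y ∈ 𝒟 | ∀ i, h i y ≤ 0}).Nonempty)
    (x : ℕ → EuclideanSpace ℝ (Fin d))
    (hx0 : x 0 ∈ 𝒟)
    (hstep : ∀ t : ℕ,
      x (t + 1) ∈ {y ∈ 𝒟 | ∀ j, 0 ≤ h j (x t) → h j y ≤ 0} ∧
        IsMinOn f {y ∈ 𝒟 | ∀ j, 0 ≤ h j (x t) → h j y ≤ 0} (x (t + 1))) :
    ∃ T : ℕ, x T ∈ {y ∈ 𝒟 | ∀ i, h i y ≤ 0} ∧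
      IsMinOn f {y ∈ 𝒟 | ∀ i, h i y ≤ 0} (x T) := by
  have hsc := strictConvexOn_of_forall_add_inner_add_le hγ hstrong
  by_cases hfix : ∃ t, x (t + 1) = x (t + 2)
  · obtain ⟨t, ht⟩ := hfix
    refine ⟨t + 1, ⟨(hstep t).1.1, fun i => ?_⟩,
      (hstep t).2.on_subset fun y hy => ⟨hy.1, fun j _ => hy.2 j⟩⟩
    rcases le_total (h i (x (t + 1))) 0 with hi | hi
    · exact hi
    · exact ht ▸ (hstep (t + 1)).1.2 i hi
  · push Not at hfix
    have hmono : StrictMono fun t => f (x (t + 1)) := strictMono_nat_of_lt_succ fun t =>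
      hsc.lt_of_isMinOn_of_active h𝒟 hconv (W := {j | 0 ≤ h j (x t)}) (hstep t).1.1
        (hstep t).1.2 (hstep t).2 (hstep (t + 1)).1.1 (hstep (t + 1)).1.2 (hfix t)
    obtain ⟨s, t, hst, hW⟩ :=
      Finite.exists_ne_map_eq_of_infinite fun t : ℕ => {j | 0 ≤ h j (x t)}
    have hiff : ∀ j, 0 ≤ h j (x s) ↔ 0 ≤ h j (x t) := fun j => Set.ext_iff.1 hW j
    refine absurd (hmono.injective (le_antisymm ?_ ?_)) hst
    · exact (hstep s).2 ⟨(hstep t).1.1, fun j hj => (hstep t).1.2 j ((hiff j).1 hj)⟩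
    · exact (hstep t).2 ⟨(hstep s).1.1, fun j hj => (hstep s).1.2 j ((hiff j).2 hj)⟩
end

section
/- Monotone upper bound for the triplet-loss coefficients (Section 5.2): let x_{i,k} ≥ 0 be nonnegative feature values and let k′ be a descendant of feature k, i.e., x_{i,k′} ≤ x_{i,k} for every sample i. Then for all sample indices i, j, l, the triplet coefficient satisfies c_{ijl,k′} := (x_{i,k′} − x_{l,k′})² − (x_{i,k′} − x_{j,k′})² ≤ max(x_{i,k}, x_{l,k})². -/
/-- Monotone upper bound for the triplet-loss coefficients (Section 5.2): if the
feature values are nonnegative and `k′` is a descendant of `k` (i.e.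
`x_{i,k′} ≤ x_{i,k}` for every sample `i`), then for all samples `i, j, l`,
`c_{ijl,k′} = (x_{i,k′} − x_{l,k′})² − (x_{i,k′} − x_{j,k′})² ≤ max(x_{i,k}, x_{l,k})²`. -/
theorem triplet_coeff_bound {n p : ℕ} (x : Fin n → Fin p → ℝ)
    (hx : ∀ i k, 0 ≤ x i k) (k k' : Fin p) (hdesc : ∀ i, x i k' ≤ x i k) :
    ∀ i j l : Fin n,
      (x i k' - x l k') ^ 2 - (x i k' - x j k') ^ 2 ≤ max (x i k) (x l k) ^ 2 := by
  intro i j l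
  have hi : x i k' ≤ max (x i k) (x l k) := (hdesc i).trans (le_max_left _ _)
  have hl : x l k' ≤ max (x i k) (x l k) := (hdesc l).trans (le_max_right _ _)
  have hdist : (x i k' - x l k') ^ 2 ≤ max (x i k) (x l k) ^ 2 :=
    sq_le_sq' (by linarith [hx i k']) (by linarith [hx l k'])
  linarith [sq_nonneg (x i k' - x j k')]
end
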